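/- arXiv:2211.12196 — 2 statements merged into one kernel-verified Lean document; each statement's English description precedes it below -/
import Mathlib

section
/- Define B_∞^i = ⋂_{l≥0} B_l^i for each i ∈ V. Then {B_∞^i}_{i∈V} is the maximal admissible invariant multi-set: (i) B_∞^i ⊆ Z for every i ∈ V; (ii) Φ(σ, B_∞^i) ⊆ B_∞^d for every edge (i, d, σ) ∈ E; and (iii) every admissible multi-set {S^i}_{i∈V} satisfying the one-step invariance condition satisfies S^i ⊆ B_∞^i for every i ∈ V. -/
/-- One-step forward reachability map `Φ`. -/
def Phi {n m p : ℕ} (A : Matrix (Fin n) (Fin n) ℝ) (B : Matrix (Fin n) (Fin m) ℝ)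
    (Ed : Matrix (Fin n) (Fin p) ℝ) (𝒜 : (Fin n → ℝ) → Set (Fin m → ℝ))
    (H : Set (Fin p → ℝ)) (S : Set (Fin n → ℝ)) : Set (Fin n → ℝ) :=
  {y | ∃ z ∈ S, ∃ a ∈ 𝒜 z, ∃ h ∈ H, y = A.mulVec z + B.mulVec a + Ed.mulVec h}

/-- One-step backward reachability map `Ψ`. -/
def Psi {n m p : ℕ} (A : Matrix (Fin n) (Fin n) ℝ) (B : Matrix (Fin n) (Fin m) ℝ)
    (Ed : Matrix (Fin n) (Fin p) ℝ) (𝒜 : (Fin n → ℝ) → Set (Fin m → ℝ))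
    (H : Set (Fin p → ℝ)) (S : Set (Fin n → ℝ)) : Set (Fin n → ℝ) :=
  {z | ∀ a ∈ 𝒜 z, ∀ h ∈ H, A.mulVec z + B.mulVec a + Ed.mulVec h ∈ S}

/-- Backward reachability multi-set sequence. -/
def Bseq {n m p : ℕ} {V Λ : Type*}
    (A : Matrix (Fin n) (Fin n) ℝ) (B : Λ → Matrix (Fin n) (Fin m) ℝ)
    (Ed : Matrix (Fin n) (Fin p) ℝ) (𝒜 : Λ → (Fin n → ℝ) → Set (Fin m → ℝ))
    (H : Set (Fin p → ℝ)) (E : Set (V × V × Λ)) (Z : Set (Fin n → ℝ)) :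
    ℕ → V → Set (Fin n → ℝ)
  | 0, _ => Z
  | l + 1, i => Z ∩ ⋂ d, ⋂ σ, ⋂ _ : (i, d, σ) ∈ E,
      Psi A (B σ) Ed (𝒜 σ) H (Bseq A B Ed 𝒜 H E Z l d)

theorem subset_Psi_iff_Phi_subset {n m p : ℕ} {A : Matrix (Fin n) (Fin n) ℝ}
    {B : Matrix (Fin n) (Fin m) ℝ} {Ed : Matrix (Fin n) (Fin p) ℝ}
    {𝒜 : (Fin n → ℝ) → Set (Fin m → ℝ)} {H : Set (Fin p → ℝ)} {S T : Set (Fin n → ℝ)} :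
    S ⊆ Psi A B Ed 𝒜 H T ↔ Phi A B Ed 𝒜 H S ⊆ T := by
  constructor
  · rintro hS _ ⟨z, hz, a, ha, h, hh, rfl⟩
    exact hS hz a ha h hh
  · exact fun hT z hz a ha h hh => hT ⟨z, hz, a, ha, h, hh, rfl⟩

theorem Psi_mono {n m p : ℕ} {A : Matrix (Fin n) (Fin n) ℝ}
    {B : Matrix (Fin n) (Fin m) ℝ} {Ed : Matrix (Fin n) (Fin p) ℝ}
    {𝒜 : (Fin n → ℝ) → Set (Fin m → ℝ)} {H : Set (Fin p → ℝ)} :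
    Monotone (Psi A B Ed 𝒜 H) :=
  fun _ _ hST _ hz a ha h hh => hST (hz a ha h hh)

/-- the intersection B_inf^i = ⋂_l B_l^i is the maximal
admissible invariant multi-set. -/
theorem Bseq_inter_maximal
    {n m p : ℕ} {V Λ : Type*} [Fintype V] [Fintype Λ]
    (A : Matrix (Fin n) (Fin n) ℝ) (B : Λ → Matrix (Fin n) (Fin m) ℝ)
    (Ed : Matrix (Fin n) (Fin p) ℝ) (𝒜 : Λ → (Fin n → ℝ) → Set (Fin m → ℝ))
    (H : Set (Fin p → ℝ)) (E : Set (V × V × Λ)) (Z : Set (Fin n → ℝ))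
    (Binf : V → Set (Fin n → ℝ))
    (hBinf : ∀ i, Binf i = ⋂ l : ℕ, Bseq A B Ed 𝒜 H E Z l i) :
    (∀ i : V, Binf i ⊆ Z) ∧
    (∀ i d σ', (i, d, σ') ∈ E →
      Phi A (B σ') Ed (𝒜 σ') H (Binf i) ⊆ Binf d) ∧
    (∀ S : V → Set (Fin n → ℝ), (∀ i, S i ⊆ Z) →
      (∀ s d σ', (s, d, σ') ∈ E → Phi A (B σ') Ed (𝒜 σ') H (S s) ⊆ S d) →
      ∀ i, S i ⊆ Binf i) := by
  refine ⟨fun i => ?_, fun i d σ hE => ?_, fun S hSZ hS i => ?_⟩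
  · rw [hBinf]
    exact Set.iInter_subset (fun l => Bseq A B Ed 𝒜 H E Z l i) 0
  · rw [hBinf d]
    refine Set.subset_iInter fun l => subset_Psi_iff_Phi_subset.1 fun z hz => ?_
    rw [hBinf i] at hz
    have hz' := (Set.mem_iInter.1 hz (l + 1)).2
    simp only [Set.mem_iInter] at hz'
    exact hz' d σ hE
  · rw [hBinf]
    refine Set.subset_iInter fun l => ?_
    induction l generalizing i with
    | zero => exact hSZ i
    | succ l ih =>
      refine Set.subset_inter (hSZ i) ?_
      refine Set.subset_iInter fun d => Set.subset_iInter fun σ => Set.subset_iInter fun hE => ?_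
      exact (subset_Psi_iff_Phi_subset.2 (hS i d σ hE)).trans (Psi_mono (ih d))
end

section
/- (Characterization of the maximal safe set.) For every z₀ ∈ ℝⁿ, one has z₀ ∈ ⋂_{i∈V} ⋂_{l≥0} B_l^i if and only if for every initial node ξ₀ ∈ V, every finite length T ≥ 0, and every admissible trajectory of length T with initial state z₀ and initial node ξ₀, it holds that z(t) ∈ Z for all 0 ≤ t ≤ T. Consequently, the set S = ⋂_{i∈V} ⋂_{l≥0} B_l^i is safe with respect to the node set V, and every set S' ⊆ ℝⁿ that is safe with respect to the node set V satisfies S' ⊆ S; i.e., S is the maximal safe set. -/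
/-- An admissible trajectory of length `T` of the constrained switching system. -/
def IsAdmissibleTraj {n m p : ℕ} {V Λ : Type*}
    (A : Matrix (Fin n) (Fin n) ℝ) (B : Λ → Matrix (Fin n) (Fin m) ℝ)
    (Ed : Matrix (Fin n) (Fin p) ℝ) (𝒜 : Λ → (Fin n → ℝ) → Set (Fin m → ℝ))
    (H : Set (Fin p → ℝ)) (E : Set (V × V × Λ)) (T : ℕ)
    (z : ℕ → Fin n → ℝ) (ξ : ℕ → V) (σ : ℕ → Λ)
    (a : ℕ → Fin m → ℝ) (h : ℕ → Fin p → ℝ) : Prop :=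
  ∀ t, t < T → (ξ t, ξ (t + 1), σ t) ∈ E ∧ a t ∈ 𝒜 (σ t) (z t) ∧ h t ∈ H ∧
    z (t + 1) = A.mulVec (z t) + (B (σ t)).mulVec (a t) + Ed.mulVec (h t)

/-- `S` is safe with respect to the node set `V`: trajectories started anywhere
in `S`, from any initial node, respect the state constraints forever. -/
def IsSafeSet {n m p : ℕ} {V Λ : Type*}
    (A : Matrix (Fin n) (Fin n) ℝ) (B : Λ → Matrix (Fin n) (Fin m) ℝ)
    (Ed : Matrix (Fin n) (Fin p) ℝ) (𝒜 : Λ → (Fin n → ℝ) → Set (Fin m → ℝ))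
    (H : Set (Fin p → ℝ)) (E : Set (V × V × Λ)) (Z : Set (Fin n → ℝ))
    (S : Set (Fin n → ℝ)) : Prop :=
  ∀ z₀ ∈ S, ∀ (ξ₀ : V) (T : ℕ) (z : ℕ → Fin n → ℝ) (ξ : ℕ → V) (σ : ℕ → Λ)
    (a : ℕ → Fin m → ℝ) (h : ℕ → Fin p → ℝ),
    z 0 = z₀ → ξ 0 = ξ₀ → IsAdmissibleTraj A B Ed 𝒜 H E T z ξ σ a h →
    ∀ t ≤ T, z t ∈ Z

theorem mem_Bseq_succ_iff {n m p : ℕ} {V Λ : Type*}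
    {A : Matrix (Fin n) (Fin n) ℝ} {B : Λ → Matrix (Fin n) (Fin m) ℝ}
    {Ed : Matrix (Fin n) (Fin p) ℝ} {𝒜 : Λ → (Fin n → ℝ) → Set (Fin m → ℝ)}
    {H : Set (Fin p → ℝ)} {E : Set (V × V × Λ)} {Z : Set (Fin n → ℝ)}
    {l : ℕ} {i : V} {x : Fin n → ℝ} :
    x ∈ Bseq A B Ed 𝒜 H E Z (l + 1) i ↔
      x ∈ Z ∧ ∀ d σ, (i, d, σ) ∈ E → ∀ a ∈ 𝒜 σ x, ∀ h ∈ H,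
        A.mulVec x + (B σ).mulVec a + Ed.mulVec h ∈ Bseq A B Ed 𝒜 H E Z l d := by
  simp only [Bseq, Psi, Set.mem_inter_iff, Set.mem_iInter, Set.mem_ofPred_eq]

theorem Bseq_subset {n m p : ℕ} {V Λ : Type*}
    {A : Matrix (Fin n) (Fin n) ℝ} {B : Λ → Matrix (Fin n) (Fin m) ℝ}
    {Ed : Matrix (Fin n) (Fin p) ℝ} {𝒜 : Λ → (Fin n → ℝ) → Set (Fin m → ℝ)}
    {H : Set (Fin p → ℝ)} {E : Set (V × V × Λ)} {Z : Set (Fin n → ℝ)}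
    (l : ℕ) (i : V) : Bseq A B Ed 𝒜 H E Z l i ⊆ Z := by
  cases l with
  | zero => exact subset_rfl
  | succ l => exact fun _ hx => (mem_Bseq_succ_iff.1 hx).1

/-- Each step along an admissible trajectory lowers the index of the reachability sequence
by one. -/
theorem IsAdmissibleTraj.mem_Bseq {n m p : ℕ} {V Λ : Type*}
    {A : Matrix (Fin n) (Fin n) ℝ} {B : Λ → Matrix (Fin n) (Fin m) ℝ}
    {Ed : Matrix (Fin n) (Fin p) ℝ} {𝒜 : Λ → (Fin n → ℝ) → Set (Fin m → ℝ)}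
    {H : Set (Fin p → ℝ)} {E : Set (V × V × Λ)} {Z : Set (Fin n → ℝ)}
    {T : ℕ} {z : ℕ → Fin n → ℝ} {ξ : ℕ → V} {σ : ℕ → Λ}
    {a : ℕ → Fin m → ℝ} {h : ℕ → Fin p → ℝ}
    (htraj : IsAdmissibleTraj A B Ed 𝒜 H E T z ξ σ a h) {t : ℕ} (ht : t ≤ T) {l : ℕ}
    (h0 : z 0 ∈ Bseq A B Ed 𝒜 H E Z (l + t) (ξ 0)) :
    z t ∈ Bseq A B Ed 𝒜 H E Z l (ξ t) := by
  induction t generalizing l with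
  | zero => exact h0
  | succ t ih =>
    have hmem : z t ∈ Bseq A B Ed 𝒜 H E Z (l + 1) (ξ t) :=
      ih (by omega) (by rwa [add_right_comm])
    obtain ⟨hE, ha, hh, hz⟩ := htraj t ht
    rw [hz]
    exact (mem_Bseq_succ_iff.1 hmem).2 _ _ hE _ ha _ hh

/-- An admissible trajectory can be extended by a step into its initial state. -/
theorem IsAdmissibleTraj.cons {n m p : ℕ} {V Λ : Type*}
    {A : Matrix (Fin n) (Fin n) ℝ} {B : Λ → Matrix (Fin n) (Fin m) ℝ}
    {Ed : Matrix (Fin n) (Fin p) ℝ} {𝒜 : Λ → (Fin n → ℝ) → Set (Fin m → ℝ)}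
    {H : Set (Fin p → ℝ)} {E : Set (V × V × Λ)}
    {T : ℕ} {z : ℕ → Fin n → ℝ} {ξ : ℕ → V} {σ : ℕ → Λ}
    {a : ℕ → Fin m → ℝ} {h : ℕ → Fin p → ℝ}
    (htraj : IsAdmissibleTraj A B Ed 𝒜 H E T z ξ σ a h)
    {x : Fin n → ℝ} {i : V} {s : Λ} {b : Fin m → ℝ} {w : Fin p → ℝ}
    (hE : (i, ξ 0, s) ∈ E) (hb : b ∈ 𝒜 s x) (hw : w ∈ H)
    (hz : z 0 = A.mulVec x + (B s).mulVec b + Ed.mulVec w) :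
    IsAdmissibleTraj A B Ed 𝒜 H E (T + 1)
      (fun t => Nat.casesOn t x z) (fun t => Nat.casesOn t i ξ)
      (fun t => Nat.casesOn t s σ) (fun t => Nat.casesOn t b a)
      (fun t => Nat.casesOn t w h) := by
  rintro (_ | t) ht
  · exact ⟨hE, hb, hw, hz⟩
  · exact htraj t (by omega)

/-- A state from which every admissible trajectory starting at node `i` ends in `Z` belongs to
every term of the reachability sequence at `i`. -/
theorem mem_Bseq_of_forall_traj {n m p : ℕ} {V Λ : Type*} [Nonempty Λ]
    {A : Matrix (Fin n) (Fin n) ℝ} {B : Λ → Matrix (Fin n) (Fin m) ℝ}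
    {Ed : Matrix (Fin n) (Fin p) ℝ} {𝒜 : Λ → (Fin n → ℝ) → Set (Fin m → ℝ)}
    {H : Set (Fin p → ℝ)} {E : Set (V × V × Λ)} {Z : Set (Fin n → ℝ)}
    (l : ℕ) {i : V} {x : Fin n → ℝ}
    (hx : ∀ (T : ℕ) (z : ℕ → Fin n → ℝ) (ξ : ℕ → V) (σ : ℕ → Λ)
      (a : ℕ → Fin m → ℝ) (h : ℕ → Fin p → ℝ),
      z 0 = x → ξ 0 = i → IsAdmissibleTraj A B Ed 𝒜 H E T z ξ σ a h → z T ∈ Z) :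
    x ∈ Bseq A B Ed 𝒜 H E Z l i := by
  have hxZ : x ∈ Z :=
    hx 0 (fun _ => x) (fun _ => i) (fun _ => Classical.arbitrary Λ) 0 0 rfl rfl
      fun t ht => absurd ht t.not_lt_zero
  induction l generalizing i x with
  | zero => exact hxZ
  | succ l ih =>
    refine mem_Bseq_succ_iff.2 ⟨hxZ, fun d s hE b hb w hw => ?_⟩
    have hnext : ∀ (T : ℕ) (z : ℕ → Fin n → ℝ) (ξ : ℕ → V) (σ : ℕ → Λ)
        (a : ℕ → Fin m → ℝ) (h : ℕ → Fin p → ℝ),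
        z 0 = A.mulVec x + (B s).mulVec b + Ed.mulVec w → ξ 0 = d →
        IsAdmissibleTraj A B Ed 𝒜 H E T z ξ σ a h → z T ∈ Z := by
      rintro T z ξ σ a h hz rfl htraj
      exact hx (T + 1) _ _ _ _ _ rfl rfl (htraj.cons hE hb hw hz)
    exact ih hnext (hnext 0 (fun _ => _) (fun _ => d) (fun _ => s) 0 0 rfl rfl
      fun t ht => absurd ht t.not_lt_zero)

/-- `⋂_{i∈V} ⋂_{l≥0} B_l^i` is exactly the set of initial states
that are safe from every initial node, and it is the maximal safe set. -/
theorem maximal_safe_set_characterization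
    {n m p : ℕ} {V Λ : Type*} [Fintype V] [Fintype Λ] [Nonempty Λ]
    (A : Matrix (Fin n) (Fin n) ℝ) (B : Λ → Matrix (Fin n) (Fin m) ℝ)
    (Ed : Matrix (Fin n) (Fin p) ℝ) (𝒜 : Λ → (Fin n → ℝ) → Set (Fin m → ℝ))
    (H : Set (Fin p → ℝ)) (E : Set (V × V × Λ)) (Z : Set (Fin n → ℝ))
    (S : Set (Fin n → ℝ))
    (hS : S = ⋂ i : V, ⋂ l : ℕ, Bseq A B Ed 𝒜 H E Z l i) :
    (∀ z₀ : Fin n → ℝ, z₀ ∈ S ↔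
      ∀ (ξ₀ : V) (T : ℕ) (z : ℕ → Fin n → ℝ) (ξ : ℕ → V) (σ : ℕ → Λ)
        (a : ℕ → Fin m → ℝ) (h : ℕ → Fin p → ℝ),
        z 0 = z₀ → ξ 0 = ξ₀ → IsAdmissibleTraj A B Ed 𝒜 H E T z ξ σ a h →
        ∀ t ≤ T, z t ∈ Z) ∧
    IsSafeSet A B Ed 𝒜 H E Z S ∧
    (∀ S' : Set (Fin n → ℝ), IsSafeSet A B Ed 𝒜 H E Z S' → S' ⊆ S) := by
  subst hS
  have key : ∀ z₀ : Fin n → ℝ, z₀ ∈ (⋂ i : V, ⋂ l : ℕ, Bseq A B Ed 𝒜 H E Z l i) ↔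
      ∀ (ξ₀ : V) (T : ℕ) (z : ℕ → Fin n → ℝ) (ξ : ℕ → V) (σ : ℕ → Λ)
        (a : ℕ → Fin m → ℝ) (h : ℕ → Fin p → ℝ),
        z 0 = z₀ → ξ 0 = ξ₀ → IsAdmissibleTraj A B Ed 𝒜 H E T z ξ σ a h →
        ∀ t ≤ T, z t ∈ Z := by
    intro z₀
    simp only [Set.mem_iInter]
    constructor
    · rintro hmem _ T z ξ σ a h rfl rfl htraj t ht
      exact Bseq_subset 0 _ (htraj.mem_Bseq ht (hmem _ _))
    · exact fun hsafe i l => mem_Bseq_of_forall_traj l fun T z ξ σ a h hz hξ htraj =>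
        hsafe i T z ξ σ a h hz hξ htraj T le_rfl
  exact ⟨key, fun z₀ hz₀ => (key z₀).1 hz₀, fun S' hS' z₀ hz₀ => (key z₀).2 (hS' z₀ hz₀)⟩
end
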